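/- Let x ∈ supp(μ) be such that (a) μ is absolutely continuous with respect to the Lebesgue measure on ℝ^d, (b) η(x) ∈ (0,1), and (c) η is continuous with respect to the Euclidean metric in a neighborhood of x. Then for any fixed k, the robustness radius ρ(A_k(S_n,·), x) of the k-nearest-neighbor classifier at x converges in probability to 0 as the sample size n → ∞; that is, for all ε > 0 and δ > 0 there exists n_0(ε,δ) such that for all n ≥ n_0(ε,δ), Pr_{S_n}( ρ(A_k(S_n,·), x) ≥ ε ) ≤ δ. -/

import Mathlib

open MeasureTheory Metric Filter
open scoped Classical ENNReal

noncomputable section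

/-- Points live in `d`-dimensional Euclidean space. -/
abbrev Pt (d : ℕ) := EuclideanSpace ℝ (Fin d)

variable {d : ℕ}

/-- The support of a measure: points all of whose neighborhoods have positive measure. -/
def msupport (μ : Measure (Pt d)) : Set (Pt d) :=
  {x | ∀ ε : ℝ, 0 < ε → 0 < μ (ball x ε)}

/-- The probability radius `r_p(x) = inf { r : μ(B(x,r)) ≥ p }`. -/
def probRadius (μ : Measure (Pt d)) (p : ℝ) (x : Pt d) : ℝ :=
  sInf {r : ℝ | ENNReal.ofReal p ≤ μ (closedBall x r)}

/-- Indices of the sample sorted by distance to `x` (ties broken by index). -/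
def nnOrder {n : ℕ} (X : Fin n → Pt d) (x : Pt d) : List (Fin n) :=
  (List.finRange n).insertionSort
    (fun i j => dist (X i) x < dist (X j) x ∨ (dist (X i) x = dist (X j) x ∧ i ≤ j))

/-- The label `Y^{(i+1)}(x)` of the `(i+1)`-st nearest neighbor of `x` in the sample `S`. -/
def nthLabel {n : ℕ} (S : Fin n → Pt d × Bool) (x : Pt d) (i : ℕ) : Bool :=
  ((nnOrder (fun j => (S j).1) x)[i]?).elim false (fun j => (S j).2)

/-- The distance from `x` to its `(i+1)`-st nearest neighbor among `X`. -/
def nthNNdist {n : ℕ} (X : Fin n → Pt d) (x : Pt d) (i : ℕ) : ℝ :=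
  (((List.finRange n).map (fun j => dist (X j) x)).insertionSort (· ≤ ·)).getD i 0

/-- The `k`-nearest-neighbor classifier: outputs 1 iff the labels of the `k` nearest
neighbors sum to at least `k/2`. -/
def kNNClassifier {n : ℕ} (S : Fin n → Pt d × Bool) (k : ℕ) (x : Pt d) : Bool :=
  if (k : ℝ) / 2 ≤ ∑ i ∈ Finset.range k, (if nthLabel S x i then (1 : ℝ) else 0)
  then true else false

/-- The Bayes optimal classifier for conditional label probability `η`. -/
def bayes (η : Pt d → ℝ) (x : Pt d) : Bool :=
  if (1 : ℝ) / 2 ≤ η x then true else false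

/-- The robustness radius `ρ(f,x) = inf { r ≥ 0 : ∃ x' ∈ B(x,r), f x' ≠ f x }`. -/
def robustRadius (f : Pt d → Bool) (x : Pt d) : ℝ :=
  sInf {r : ℝ | 0 ≤ r ∧ ∃ x' ∈ closedBall x r, f x' ≠ f x}

/-- Astuteness of classifier `f` at radius `r` w.r.t. the data distribution `D`. -/
def astuteness (D : Measure (Pt d × Bool)) (f : Pt d → Bool) (r : ℝ) : ℝ :=
  (D {py : Pt d × Bool | r ≤ robustRadius f py.1 ∧ f py.1 = py.2}).toReal

/-- `η` is (a measurable, `[0,1]`-valued version of) the conditional probability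
`Pr(Y = 1 | X = x)` under the joint distribution `D`. -/
def IsCondProb (D : Measure (Pt d × Bool)) (η : Pt d → ℝ) : Prop :=
  Measurable η ∧ (∀ z, η z ∈ Set.Icc (0 : ℝ) 1) ∧
    ∀ A : Set (Pt d), MeasurableSet A →
      D (A ×ˢ ({true} : Set Bool)) = ∫⁻ z in A, ENNReal.ofReal (η z) ∂(D.map Prod.fst)

/-- The strict `r`-robust `(p,Δ)`-interior of the positive region. -/
def Xp (μ : Measure (Pt d)) (η : Pt d → ℝ) (r Δ p : ℝ) : Set (Pt d) :=
  {x | x ∈ msupport μ ∧ ∀ x' ∈ ball x r, ∀ x'' ∈ closedBall x' (probRadius μ p x'),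
    1 / 2 + Δ < η x''}

/-- The strict `r`-robust `(p,Δ)`-interior of the negative region. -/
def Xm (μ : Measure (Pt d)) (η : Pt d → ℝ) (r Δ p : ℝ) : Set (Pt d) :=
  {x | x ∈ msupport μ ∧ ∀ x' ∈ ball x r, ∀ x'' ∈ closedBall x' (probRadius μ p x'),
    η x'' < 1 / 2 - Δ}

/-- The (non-strict) `r`-robust `(p,Δ)`-interior of the positive region. -/
def XpHat (μ : Measure (Pt d)) (η : Pt d → ℝ) (r Δ p : ℝ) : Set (Pt d) :=
  {x | x ∈ msupport μ ∧ ∀ x' ∈ ball x r, ∀ x'' ∈ closedBall x' (probRadius μ p x'),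
    1 / 2 + Δ ≤ η x''}

/-- The (non-strict) `r`-robust `(p,Δ)`-interior of the negative region. -/
def XmHat (μ : Measure (Pt d)) (η : Pt d → ℝ) (r Δ p : ℝ) : Set (Pt d) :=
  {x | x ∈ msupport μ ∧ ∀ x' ∈ ball x r, ∀ x'' ∈ closedBall x' (probRadius μ p x'),
    η x'' ≤ 1 / 2 - Δ}

/-- The distribution of an i.i.d. sample of size `n` from `D`. -/
def Pn (D : Measure (Pt d × Bool)) (n : ℕ) : Measure (Fin n → Pt d × Bool) :=
  Measure.pi fun _ : Fin n => D

/-- `J(B) = E[Y · 1(X ∈ B)]` for `{0,1}`-valued labels. -/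
def Jtrue (D : Measure (Pt d × Bool)) (B : Set (Pt d)) : ℝ :=
  (D (B ×ˢ ({true} : Set Bool))).toReal

/-- The empirical counterpart `Ĵ(B)` of `J(B)`. -/
def Jhat {n : ℕ} (S : Fin n → Pt d × Bool) (B : Set (Pt d)) : ℝ :=
  (1 / (n : ℝ)) * ∑ i : Fin n, (if (S i).2 = true ∧ (S i).1 ∈ B then (1 : ℝ) else 0)

/-- A labeled set is `r`-separated if points within distance `r` share the same label. -/
def RSeparated (A : Set (Pt d × Bool)) (r : ℝ) : Prop :=
  ∀ p ∈ A, ∀ q ∈ A, dist p.1 q.1 ≤ r → p.2 = q.2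

/-- The 1-nearest-neighbor classifier on a finite labeled list (ties broken by list order,
and the empty list classifies everything as `false`). -/
def oneNN (S : List (Pt d × Bool)) (x : Pt d) : Bool :=
  ((S.insertionSort (fun a b => dist a.1 x ≤ dist b.1 x))[0]?).elim false Prod.snd

/-- The Confident-Label subroutine with `K` neighbors and margin `Δ`: returns `none` (⊥)
if the average label of the `K` nearest neighbors of `x` is within `Δ` of `1/2`, and the
majority label otherwise. -/
def confLabel {n : ℕ} (S : Fin n → Pt d × Bool) (K : ℕ) (Δ : ℝ) (x : Pt d) : Option Bool :=
  if (1 / (K : ℝ)) * ∑ i ∈ Finset.range K, (if nthLabel S x i then (1 : ℝ) else 0)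
      ∈ Set.Icc (1 / 2 - Δ) (1 / 2 + Δ) then none
  else if 1 / 2 < (1 / (K : ℝ)) * ∑ i ∈ Finset.range K, (if nthLabel S x i then (1 : ℝ) else 0)
  then some true else some false

/-- The point `(X_i, Y_i)` is marked Red by Robust_1NN: Confident-Label outputs `Y_i` at `X_i`
and outputs the same value at every sample point within distance `r` of `X_i`. -/
def markedRed {n : ℕ} (S : Fin n → Pt d × Bool) (K : ℕ) (Δ r : ℝ) (i : Fin n) : Prop :=
  confLabel S K Δ (S i).1 = some (S i).2 ∧
    ∀ j : Fin n, dist (S i).1 (S j).1 ≤ r → confLabel S K Δ (S j).1 = confLabel S K Δ (S i).1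



lemma aux_nnOrder_perm {n : ℕ} (X : Fin n → Pt d) (x : Pt d) :
    (nnOrder X x).Perm (List.finRange n) := List.perm_insertionSort _ _

lemma aux_nnOrder_sorted {n : ℕ} (X : Fin n → Pt d) (x : Pt d) :
    (nnOrder X x).Pairwise (fun i j => dist (X i) x ≤ dist (X j) x) := by
  set r : Fin n → Fin n → Prop :=
    (fun i j => dist (X i) x < dist (X j) x ∨ (dist (X i) x = dist (X j) x ∧ i ≤ j)) with hr
  have : Std.Total r := ⟨by
    intro a b
    simp only [hr]
    rcases lt_trichotomy (dist (X a) x) (dist (X b) x) with h | h | h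
    · exact Or.inl (Or.inl h)
    · rcases le_total a b with h' | h'
      · exact Or.inl (Or.inr ⟨h, h'⟩)
      · exact Or.inr (Or.inr ⟨h.symm, h'⟩)
    · exact Or.inr (Or.inl h)⟩
  have : IsTrans (Fin n) r := ⟨by
    intro a b c h1 h2
    simp only [hr] at *
    rcases h1 with h1 | ⟨h1, h1'⟩ <;> rcases h2 with h2 | ⟨h2, h2'⟩
    · exact Or.inl (h1.trans h2)
    · exact Or.inl (h2 ▸ h1)
    · exact Or.inl (h1 ▸ h2)
    · exact Or.inr ⟨h1.trans h2, h1'.trans h2'⟩⟩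
  have h := List.pairwise_insertionSort r (List.finRange n)
  refine List.Pairwise.imp ?_ h
  intro a b hab
  rcases hab with h | h
  · exact h.le
  · exact h.1.le

lemma aux_nnOrder_length {n : ℕ} (X : Fin n → Pt d) (x : Pt d) :
    (nnOrder X x).length = n := by
  rw [(aux_nnOrder_perm X x).length_eq, List.length_finRange]

lemma aux_nnOrder_nodup {n : ℕ} (X : Fin n → Pt d) (x : Pt d) :
    (nnOrder X x).Nodup :=
  (aux_nnOrder_perm X x).nodup_iff.2 (List.nodup_finRange n)

/-- if the ball contains at least `k` samples, the `k` nearest neighbours are in the ball -/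
lemma aux_take_mem {n : ℕ} (X : Fin n → Pt d) (z : Pt d) (s : ℝ) (k : ℕ)
    (hk : k ≤ (Finset.univ.filter (fun i => X i ∈ ball z s)).card) :
    ∀ a ∈ (nnOrder X z).take k, X a ∈ ball z s := by
  intro a ha
  by_contra hnot
  set L := nnOrder X z
  have hsplit : L.take k ++ L.drop k = L := List.take_append_drop k L
  have hs := aux_nnOrder_sorted X z
  change L.Pairwise _ at hs
  rw [← hsplit, List.pairwise_append] at hs
  have hsub : Finset.univ.filter (fun i => X i ∈ ball z s) ⊆ (L.take k).toFinset.erase a := by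
    intro i hi
    simp only [Finset.mem_filter, Finset.mem_univ, true_and] at hi
    rw [Finset.mem_erase, List.mem_toFinset]
    refine ⟨fun h => hnot (h ▸ hi), ?_⟩
    have hiL : i ∈ L := (aux_nnOrder_perm X z).mem_iff.2 (List.mem_finRange i)
    rw [← hsplit, List.mem_append] at hiL
    rcases hiL with h | h
    · exact h
    · exfalso
      have := hs.2.2 a ha i h
      apply hnot
      rw [mem_ball] at *
      exact this.trans_lt hi
  have h1 := Finset.card_le_card hsub
  rw [Finset.card_erase_of_mem (List.mem_toFinset.2 ha)] at h1
  have h2 : (L.take k).toFinset.card ≤ k :=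
    (List.toFinset_card_le _).trans (by simp)
  have h3 : 0 < (L.take k).toFinset.card := Finset.card_pos.2 ⟨a, List.mem_toFinset.2 ha⟩
  omega

lemma aux_classifier {n : ℕ} (S : Fin n → Pt d × Bool) (k : ℕ) (hk : 0 < k) (hkn : k ≤ n)
    (z : Pt d) (b : Bool)
    (h : ∀ a ∈ (nnOrder (fun j => (S j).1) z).take k, (S a).2 = b) :
    kNNClassifier S k z = b := by
  have hl : ∀ i < k, nthLabel S z i = b := by
    intro i hi
    have hlt : i < (nnOrder (fun j => (S j).1) z).length := by
      rw [aux_nnOrder_length]; omega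
    unfold nthLabel
    rw [List.getElem?_eq_getElem hlt]
    simp only [Option.elim]
    apply h
    rw [List.mem_take_iff_getElem]
    exact ⟨i, by omega, rfl⟩
  have hsum : ∑ i ∈ Finset.range k, (if nthLabel S z i then (1 : ℝ) else 0)
      = ∑ i ∈ Finset.range k, (if b then (1 : ℝ) else 0) :=
    Finset.sum_congr rfl fun i hi => by rw [hl i (Finset.mem_range.1 hi)]
  have hk' : (0 : ℝ) < k := by exact_mod_cast hk
  unfold kNNClassifier
  rw [hsum]
  cases b
  · simp [hk]
  · simp

lemma aux_meas_classifier {n : ℕ} (k : ℕ) (z : Pt d) :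
    Measurable (fun S : Fin n → Pt d × Bool => kNNClassifier S k z) := by
  let g : (Fin n → Fin n → Bool) × (Fin n → Bool) → Bool := fun p =>
    if (k : ℝ) / 2 ≤ ∑ i ∈ Finset.range k,
      (if ((((List.finRange n).insertionSort (fun i j => p.1 i j = true))[i]?).elim false p.2)
        then (1 : ℝ) else 0)
    then true else false
  let m : (Fin n → Pt d × Bool) → (Fin n → Fin n → Bool) × (Fin n → Bool) := fun S =>
    (fun i j => decide (dist (S i).1 z < dist (S j).1 z ∨
      (dist (S i).1 z = dist (S j).1 z ∧ i ≤ j)), fun i => (S i).2)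
  have hm : Measurable m := by
    have hd : ∀ i, Measurable (fun S : Fin n → Pt d × Bool => dist (S i).1 z) := fun i =>
      ((measurable_pi_apply i).fst).dist measurable_const
    refine Measurable.prodMk ?_ ?_
    · refine measurable_pi_lambda _ fun i => measurable_pi_lambda _ fun j => ?_
      apply measurable_to_bool
      have : ((fun S : Fin n → Pt d × Bool => decide (dist (S i).1 z < dist (S j).1 z ∨
          (dist (S i).1 z = dist (S j).1 z ∧ i ≤ j))) ⁻¹' {true}) =
          {S | dist (S i).1 z < dist (S j).1 z} ∪
            ({S | dist (S i).1 z = dist (S j).1 z} ∩ {S | i ≤ j}) := by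
        ext S; simp
      rw [this]
      exact (measurableSet_lt (hd i) (hd j)).union
        ((measurableSet_eq_fun (hd i) (hd j)).inter (MeasurableSet.const _))
    · exact measurable_pi_lambda _ fun i => (measurable_pi_apply i).snd
  have hg : Measurable g := measurable_of_finite g
  have : (fun S : Fin n → Pt d × Bool => kNNClassifier S k z) = g ∘ m := by
    funext S
    simp only [g, m, Function.comp, kNNClassifier, nthLabel, nnOrder, decide_eq_true_eq]
    congr!
  rw [this]
  exact hg.comp hm

/-- auxiliary uniform law on `[0,1]` -/
def auxUnif : Measure ℝ := volume.restrict (Set.Icc 0 1)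

instance : IsProbabilityMeasure auxUnif := ⟨by simp [auxUnif]⟩

lemma auxUnif_lt {c : ℝ} (h0 : 0 ≤ c) (h1 : c ≤ 1) :
    auxUnif {u | u < c} = ENNReal.ofReal c := by
  rw [auxUnif, Measure.restrict_apply (show MeasurableSet {u | u < c} from measurableSet_Iio)]
  have : {u | u < c} ∩ Set.Icc 0 1 = Set.Ico 0 c := by
    ext u; simp only [Set.mem_inter_iff, Set.mem_setOf_eq, Set.mem_Icc, Set.mem_Ico]
    constructor
    · rintro ⟨a, b, _⟩; exact ⟨b, a⟩
    · rintro ⟨a, b⟩; exact ⟨b, a, by linarith⟩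
  rw [this]; simp

lemma auxUnif_gt {c : ℝ} (h0 : 0 ≤ c) (h1 : c ≤ 1) :
    auxUnif {u | 1 - c < u} = ENNReal.ofReal c := by
  rw [auxUnif, Measure.restrict_apply (show MeasurableSet {u | 1 - c < u} from measurableSet_Ioi)]
  have : {u | 1 - c < u} ∩ Set.Icc 0 1 = Set.Ioc (1 - c) 1 := by
    ext u; simp only [Set.mem_inter_iff, Set.mem_setOf_eq, Set.mem_Icc, Set.mem_Ioc]
    constructor
    · rintro ⟨a, _, b⟩; exact ⟨a, b⟩
    · rintro ⟨a, b⟩; exact ⟨a, by linarith, b⟩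
  rw [this]; simp

/-- the coupling map -/
def auxLab (η : Pt d → ℝ) (p : Pt d × ℝ) : Pt d × Bool := (p.1, decide (p.2 < η p.1))

lemma auxLab_meas {η : Pt d → ℝ} (hη : Measurable η) : Measurable (auxLab η) := by
  refine measurable_fst.prodMk (measurable_to_bool ?_)
  have : ((fun p : Pt d × ℝ => decide (p.2 < η p.1)) ⁻¹' {true}) = {p | p.2 < η p.1} := by
    ext; simp
  rw [this]
  exact measurableSet_lt measurable_snd (hη.comp measurable_fst)

lemma aux_coupling (D : Measure (Pt d × Bool)) [IsProbabilityMeasure D]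
    (η : Pt d → ℝ) (hη : IsCondProb D η) :
    MeasurePreserving (auxLab η) ((D.map Prod.fst).prod auxUnif) D := by
  obtain ⟨hm, h01, hD⟩ := hη
  have : IsProbabilityMeasure (D.map Prod.fst) :=
    Measure.isProbabilityMeasure_map measurable_fst.aemeasurable
  refine ⟨auxLab_meas hm, ?_⟩
  set E := ((D.map Prod.fst).prod auxUnif).map (auxLab η) with hE
  have : IsProbabilityMeasure E :=
    Measure.isProbabilityMeasure_map (auxLab_meas hm).aemeasurable
  have htrue : ∀ A : Set (Pt d), MeasurableSet A →
      E (A ×ˢ ({true} : Set Bool)) = D (A ×ˢ ({true} : Set Bool)) := by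
    intro A hA
    rw [hD A hA, hE, Measure.map_apply (auxLab_meas hm) (hA.prod (measurableSet_singleton _)),
      Measure.prod_apply (auxLab_meas hm (hA.prod (measurableSet_singleton _))),
      ← lintegral_indicator hA]
    refine lintegral_congr fun z => ?_
    by_cases hz : z ∈ A
    · rw [Set.indicator_of_mem hz, ← auxUnif_lt (h01 z).1 (h01 z).2]
      congr 1; ext u; simp [auxLab, hz]
    · rw [Set.indicator_of_notMem hz]
      convert measure_empty (μ := auxUnif)
      ext u; simp [auxLab, hz]
  have hall : ∀ A : Set (Pt d), MeasurableSet A →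
      E (A ×ˢ (Set.univ : Set Bool)) = D (A ×ˢ (Set.univ : Set Bool)) := by
    intro A hA
    rw [hE, Measure.map_apply (auxLab_meas hm) (hA.prod MeasurableSet.univ)]
    have h1 : auxLab η ⁻¹' (A ×ˢ Set.univ) = A ×ˢ (Set.univ : Set ℝ) := by
      ext p; simp only [auxLab, Set.mem_preimage, Set.mem_prod, Set.mem_univ]
    rw [h1, Measure.prod_prod, Measure.map_apply measurable_fst hA, measure_univ, mul_one]
    congr 1; ext p; simp
  have hfalse : ∀ A : Set (Pt d), MeasurableSet A →
      E (A ×ˢ ({false} : Set Bool)) = D (A ×ˢ ({false} : Set Bool)) := by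
    intro A hA
    have h1 : A ×ˢ ({false} : Set Bool) = A ×ˢ (Set.univ : Set Bool) \ A ×ˢ ({true} : Set Bool) := by
      ext ⟨a, b⟩; cases b <;> simp
    have hsub : A ×ˢ ({true} : Set Bool) ⊆ A ×ˢ (Set.univ : Set Bool) :=
      Set.prod_mono subset_rfl (Set.subset_univ _)
    have hmt := hA.prod (measurableSet_singleton true)
    rw [h1, measure_sdiff hsub hmt.nullMeasurableSet (measure_ne_top _ _),
      measure_sdiff hsub hmt.nullMeasurableSet (measure_ne_top _ _), htrue A hA, hall A hA]
  ext s hs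
  have hst : MeasurableSet ((fun z => (z, true)) ⁻¹' s : Set (Pt d)) :=
    (measurable_id.prodMk measurable_const) hs
  have hsf : MeasurableSet ((fun z => (z, false)) ⁻¹' s : Set (Pt d)) :=
    (measurable_id.prodMk measurable_const) hs
  have hdec : s = ((fun z => (z, true)) ⁻¹' s : Set (Pt d)) ×ˢ ({true} : Set Bool) ∪
      ((fun z => (z, false)) ⁻¹' s : Set (Pt d)) ×ˢ ({false} : Set Bool) := by
    ext ⟨a, b⟩; cases b <;> simp
  have hdisj : Disjoint (((fun z => (z, true)) ⁻¹' s : Set (Pt d)) ×ˢ ({true} : Set Bool))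
      (((fun z => (z, false)) ⁻¹' s : Set (Pt d)) ×ˢ ({false} : Set Bool)) := by
    rw [Set.disjoint_left]
    rintro ⟨a, b⟩ h1 h2
    simp at h1 h2
    simp [h1.2] at h2
  rw [hdec, measure_union hdisj (hsf.prod (measurableSet_singleton _)),
    measure_union hdisj (hsf.prod (measurableSet_singleton _)), htrue _ hst, hfalse _ hsf]

/-- the coupling on samples -/
lemma aux_coupling_n (D : Measure (Pt d × Bool)) [IsProbabilityMeasure D]
    (η : Pt d → ℝ) (hη : IsCondProb D η) (n : ℕ) :
    MeasurePreserving (fun (p : (Fin n → Pt d) × (Fin n → ℝ)) i => auxLab η (p.1 i, p.2 i))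
      ((Measure.pi fun _ : Fin n => D.map Prod.fst).prod (Measure.pi fun _ : Fin n => auxUnif))
      (Pn D n) := by
  have : IsProbabilityMeasure (D.map Prod.fst) :=
    Measure.isProbabilityMeasure_map measurable_fst.aemeasurable
  have h1 := measurePreserving_arrowProdEquivProdArrow (Pt d) ℝ (Fin n)
    (fun _ => D.map Prod.fst) (fun _ => auxUnif)
  have h2 := measurePreserving_pi (fun _ : Fin n => (D.map Prod.fst).prod auxUnif)
    (fun _ : Fin n => D) (fun _ => aux_coupling D η hη)
  exact h2.comp (h1.symm _)

lemma aux_blocks {n : ℕ} (k : ℕ) (G : Set ℝ) (hG : MeasurableSet G)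
    {ι : Type*} (I : ι → Finset (Fin n)) (t : Finset ι)
    (hI : ∀ j ∈ t, (I j).card = k)
    (hdisj : ∀ j ∈ t, ∀ j' ∈ t, j ≠ j' → Disjoint (I j) (I j')) :
    (Measure.pi fun _ : Fin n => auxUnif) {u | ∀ j ∈ t, ∃ i ∈ I j, u i ∉ G}
      ≤ (1 - auxUnif G ^ k) ^ t.card := by
  induction t using Finset.induction_on with
  | empty => simp
  | insert a t ha ih =>
    have hind : ProbabilityTheory.iIndepFun (fun (i : Fin n) (u : Fin n → ℝ) => u i)
        (Measure.pi fun _ : Fin n => auxUnif) :=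
      ProbabilityTheory.iIndepFun_pi (X := fun _ x => x) (fun i => aemeasurable_id)
    have hd : Disjoint (I a) (t.biUnion I) := by
      rw [Finset.disjoint_biUnion_right]
      intro j hj
      exact hdisj a (Finset.mem_insert_self _ _) j (Finset.mem_insert_of_mem hj)
        (fun h => ha (h ▸ hj))
    have hfs := hind.indepFun_finset (I a) (t.biUnion I) hd (fun i => measurable_pi_apply i)
    have hA : MeasurableSet {v : I a → ℝ | ∃ i, v i ∉ G} := by
      have : {v : I a → ℝ | ∃ i, v i ∉ G} = ⋃ i, (fun v : I a → ℝ => v i) ⁻¹' Gᶜ := by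
        ext v; simp
      rw [this]
      exact MeasurableSet.iUnion fun i => measurable_pi_apply i hG.compl
    have hB : MeasurableSet {v : ↥(t.biUnion I) → ℝ |
        ∀ j, ∀ hj : j ∈ t, ∃ i, ∃ hi : i ∈ I j, v ⟨i, Finset.mem_biUnion.2 ⟨j, hj, hi⟩⟩ ∉ G} := by
      have : {v : ↥(t.biUnion I) → ℝ |
        ∀ j, ∀ hj : j ∈ t, ∃ i, ∃ hi : i ∈ I j, v ⟨i, Finset.mem_biUnion.2 ⟨j, hj, hi⟩⟩ ∉ G}
        = ⋂ j : t, ⋃ i : I j, (fun v : ↥(t.biUnion I) → ℝ =>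
            v ⟨i.1, Finset.mem_biUnion.2 ⟨j.1, j.2, i.2⟩⟩) ⁻¹' Gᶜ := by
        ext v; simp
      rw [this]
      exact MeasurableSet.iInter fun j => MeasurableSet.iUnion fun i =>
        measurable_pi_apply _ hG.compl
    have hmul := hfs.measure_inter_preimage_eq_mul _ _ hA hB
    have hset : {u : Fin n → ℝ | ∀ j ∈ insert a t, ∃ i ∈ I j, u i ∉ G} =
      (fun (u : Fin n → ℝ) (i : I a) => u i) ⁻¹' {v : I a → ℝ | ∃ i, v i ∉ G} ∩
      (fun (u : Fin n → ℝ) (i : ↥(t.biUnion I)) => u i) ⁻¹'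
        {v : ↥(t.biUnion I) → ℝ |
        ∀ j, ∀ hj : j ∈ t, ∃ i, ∃ hi : i ∈ I j,
          v ⟨i, Finset.mem_biUnion.2 ⟨j, hj, hi⟩⟩ ∉ G} := by
      ext u; simp
    rw [hset, hmul, Finset.card_insert_of_notMem ha, pow_succ, mul_comm]
    refine mul_le_mul' ?_ ?_
    · refine le_trans (le_of_eq ?_) (ih (fun j hj => hI j (Finset.mem_insert_of_mem hj))
        (fun j hj j' hj' => hdisj j (Finset.mem_insert_of_mem hj) j'
          (Finset.mem_insert_of_mem hj')))
      congr 1; ext u; simp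
    · have hbox : MeasurableSet (Set.pi Set.univ (fun i : Fin n => if i ∈ I a then G else Set.univ)) :=
        MeasurableSet.univ_pi fun i => by split_ifs <;> simp [hG]
      have hc : (fun (u : Fin n → ℝ) (i : I a) => u i) ⁻¹' {v : I a → ℝ | ∃ i, v i ∉ G} =
          (Set.pi Set.univ (fun i : Fin n => if i ∈ I a then G else Set.univ))ᶜ := by
        ext u
        simp only [Set.mem_preimage, Set.mem_setOf_eq, Set.mem_compl_iff, Set.mem_pi,
          Set.mem_univ, true_implies, not_forall]
        constructor
        · rintro ⟨i, hi⟩; exact ⟨i, by simpa using hi⟩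
        · rintro ⟨i, hi⟩
          by_cases h : i ∈ I a
          · exact ⟨⟨i, h⟩, by simpa [h] using hi⟩
          · simp [h] at hi
      rw [hc, prob_compl_eq_one_sub hbox, Measure.pi_pi]
      refine le_of_eq ?_
      congr 1
      have : ∀ i : Fin n, auxUnif (if i ∈ I a then G else Set.univ) =
          if i ∈ I a then auxUnif G else 1 := by
        intro i; split_ifs <;> simp
      simp_rw [this]
      rw [Finset.prod_ite_mem, Finset.univ_inter, Finset.prod_const,
        hI a (Finset.mem_insert_self _ _)]

lemma aux_card_mod (n k j : ℕ) (hj : j < k) :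
    n / k ≤ (Finset.univ.filter (fun i : Fin n => i.val % k = j)).card := by
  have hk : 0 < k := by omega
  have h := Finset.card_le_card_of_surjOn (s := Finset.univ.filter (fun i : Fin n => i.val % k = j))
    (t := Finset.range (n / k)) (fun i : Fin n => i.val / k) (by
      intro m hm
      have hm' : m < n / k := by simpa using hm
      have h1 : k * (m + 1) ≤ n :=
        (Nat.mul_le_mul_left k hm').trans (Nat.mul_div_le n k)
      have h2 : j + k * m < n := by
        have : k * (m + 1) = k * m + k := by ring
        omega
      refine ⟨⟨j + k * m, h2⟩, ?_, ?_⟩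
      · simp [Nat.add_mul_mod_self_left, Nat.mod_eq_of_lt hj]
      · simp [Nat.add_mul_div_left _ _ hk, Nat.div_eq_of_lt hj])
  simpa using h

lemma aux_count_bound (μ : Measure (Pt d)) [IsProbabilityMeasure μ] (B : Set (Pt d))
    (n k : ℕ) :
    (Measure.pi fun _ : Fin n => μ)
      {X | (Finset.univ.filter (fun i => X i ∈ B)).card < k} ≤ k * (μ Bᶜ) ^ (n / k) := by
  have hsub : {X : Fin n → Pt d | (Finset.univ.filter (fun i => X i ∈ B)).card < k} ⊆
      ⋃ j ∈ Finset.range k,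
        Set.pi Set.univ (fun i : Fin n => if i.val % k = j then Bᶜ else Set.univ) := by
    intro X hX
    by_contra hcon
    simp only [Set.mem_iUnion, not_exists, Finset.mem_range, Set.mem_pi, Set.mem_univ,
      true_implies, not_forall] at hcon
    have hX' : (Finset.univ.filter (fun i => X i ∈ B)).card < k := hX
    have h := Finset.card_le_card_of_surjOn (s := Finset.univ.filter (fun i => X i ∈ B))
      (t := Finset.range k) (fun i : Fin n => i.val % k) (by
        intro j hj
        obtain ⟨i, hi⟩ := hcon j (by simpa using hj)
        by_cases h : i.val % k = j
        · refine ⟨i, ?_, h⟩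
          simpa [h] using hi
        · simp [h] at hi)
    rw [Finset.card_range] at h
    omega
  refine (measure_mono hsub).trans ((measure_biUnion_finset_le _ _).trans ?_)
  have : ∀ j ∈ Finset.range k, (Measure.pi fun _ : Fin n => μ)
      (Set.pi Set.univ (fun i : Fin n => if i.val % k = j then Bᶜ else Set.univ))
      ≤ (μ Bᶜ) ^ (n / k) := by
    intro j hj
    rw [Measure.pi_pi]
    have h1 : ∀ i : Fin n, μ (if i.val % k = j then Bᶜ else Set.univ) =
        if i.val % k = j then μ Bᶜ else 1 := by
      intro i; split_ifs <;> simp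
    simp_rw [h1]
    rw [← Finset.prod_filter, Finset.prod_const]
    exact pow_le_pow_right_of_le_one' prob_le_one (aux_card_mod n k j (Finset.mem_range.1 hj))
  refine (Finset.sum_le_sum this).trans ?_
  simp

lemma aux_count_tendsto (μ : Measure (Pt d)) [IsProbabilityMeasure μ] (B : Set (Pt d))
    (hB : MeasurableSet B) (hpos : 0 < μ B) (k : ℕ) (hk : 0 < k) :
    Tendsto (fun n : ℕ => (Measure.pi fun _ : Fin n => μ)
      {X | (Finset.univ.filter (fun i => X i ∈ B)).card < k}) atTop (nhds 0) := by
  have hlt : μ Bᶜ < 1 := by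
    rw [prob_compl_eq_one_sub hB]
    exact ENNReal.sub_lt_self ENNReal.one_ne_top one_ne_zero hpos.ne'
  have h1 : Tendsto (fun n : ℕ => (μ Bᶜ) ^ (n / k)) atTop (nhds 0) :=
    (ENNReal.tendsto_pow_atTop_nhds_zero_of_lt_one hlt).comp
      (Nat.tendsto_div_const_atTop hk.ne')
  have h2 : Tendsto (fun n : ℕ => (k : ℝ≥0∞) * (μ Bᶜ) ^ (n / k)) atTop (nhds 0) := by
    have := ENNReal.Tendsto.const_mul (a := (k : ℝ≥0∞)) h1 (Or.inr (ENNReal.natCast_ne_top k))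
    simpa using this
  exact tendsto_of_tendsto_of_tendsto_of_le_of_le tendsto_const_nhds h2 (fun _ => zero_le)
    (fun n => aux_count_bound μ B n k)

lemma aux_support_infinite [Nonempty (Fin d)] (μ : Measure (Pt d))
    (hac : μ ≪ (volume : Measure (Pt d))) (x : Pt d) (hx : x ∈ msupport μ) (r : ℝ) (hr : 0 < r) :
    (msupport μ ∩ ball x r).Infinite := by
  intro hfin
  have h0 : μ (msupport μ ∩ ball x r) = 0 := hac (hfin.measure_zero _)
  have hs : μ.support ⊆ msupport μ := by
    intro y hy e he
    exact (Measure.mem_support_iff_forall y).1 hy _ (ball_mem_nhds y he)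
  have h1 : μ (ball x r) ≤ μ (msupport μ ∩ ball x r) + μ μ.supportᶜ := by
    refine (measure_mono ?_).trans (measure_union_le _ _)
    intro y hy
    by_cases h : y ∈ μ.support
    · exact Or.inl ⟨hs h, hy⟩
    · exact Or.inr h
  rw [h0, Measure.measure_compl_support, add_zero] at h1
  exact absurd (hx r hr) (not_lt.2 h1)

lemma aux_points [Nonempty (Fin d)] (μ : Measure (Pt d))
    (hac : μ ≪ (volume : Measure (Pt d))) (x : Pt d) (hx : x ∈ msupport μ) (r : ℝ) (hr : 0 < r)
    (M : ℕ) :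
    ∃ t : Finset (Pt d), t.card = M ∧ ∃ s > (0 : ℝ),
      (∀ z ∈ t, 0 < μ (ball z s) ∧ z ∈ ball x r ∧ ball z s ⊆ ball x r) ∧
      (∀ z ∈ t, ∀ z' ∈ t, z ≠ z' → Disjoint (ball z s) (ball z' s)) := by
  obtain ⟨t, ht, hcard⟩ := (aux_support_infinite μ hac x hx r hr).exists_subset_card_eq M
  refine ⟨t, hcard, ?_⟩
  have hA : ∀ᶠ s in nhdsWithin (0 : ℝ) (Set.Ioi 0), ∀ z ∈ t, ball z s ⊆ ball x r := by
    rw [Filter.eventually_all_finset]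
    intro z hz
    have hz' : dist z x < r := (ht hz).2
    have : ∀ᶠ s in nhdsWithin (0 : ℝ) (Set.Ioi 0), s < r - dist z x :=
      nhdsWithin_le_nhds (Iio_mem_nhds (by linarith))
    filter_upwards [this] with s hs
    exact ball_subset_ball' (by linarith)
  have hB : ∀ᶠ s in nhdsWithin (0 : ℝ) (Set.Ioi 0), ∀ z ∈ t, ∀ z' ∈ t, z ≠ z' →
      Disjoint (ball z s) (ball z' s) := by
    rw [Filter.eventually_all_finset]
    intro z hz
    rw [Filter.eventually_all_finset]
    intro z' hz'
    by_cases h : z = z'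
    · simp [h]
    have hd : 0 < dist z z' := dist_pos.2 h
    have : ∀ᶠ s in nhdsWithin (0 : ℝ) (Set.Ioi 0), s < dist z z' / 2 :=
      nhdsWithin_le_nhds (Iio_mem_nhds (by linarith))
    filter_upwards [this] with s hs _
    exact ball_disjoint_ball (by linarith)
  obtain ⟨s, h1, h2, h3⟩ := (hA.and (hB.and self_mem_nhdsWithin)).exists
  exact ⟨s, h3, fun z hz => ⟨(ht hz).1 s h3, (ht hz).2, h1 z hz⟩, h2⟩

lemma aux_main (D : Measure (Pt d × Bool)) [IsProbabilityMeasure D]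
    (η : Pt d → ℝ) (hη : IsCondProb D η) (k : ℕ) (hk : 0 < k) (n : ℕ)
    (t : Finset (Pt d)) (s : ℝ)
    (hdisj : ∀ z ∈ t, ∀ z' ∈ t, z ≠ z' → Disjoint (ball z s) (ball z' s))
    (G : Set ℝ) (hG : MeasurableSet G) (b : Bool)
    (hb : ∀ z ∈ t, ∀ y ∈ ball z s, ∀ u ∈ G, decide (u < η y) = b) :
    Pn D n {S | ∀ z ∈ t, kNNClassifier S k z ≠ b} ≤
      (∑ z ∈ t, (Measure.pi fun _ : Fin n => D.map Prod.fst)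
        {X | (Finset.univ.filter (fun i => X i ∈ ball z s)).card < k}) +
      (1 - auxUnif G ^ k) ^ t.card := by
  have : IsProbabilityMeasure (D.map Prod.fst) :=
    Measure.isProbabilityMeasure_map measurable_fst.aemeasurable
  have hc := aux_coupling_n D η hη n
  have hmeas : MeasurableSet {S : Fin n → Pt d × Bool | ∀ z ∈ t, kNNClassifier S k z ≠ b} := by
    have : {S : Fin n → Pt d × Bool | ∀ z ∈ t, kNNClassifier S k z ≠ b} =
      ⋂ z ∈ t, (fun S => kNNClassifier S k z) ⁻¹' {b}ᶜ := by
      ext S; simp only [Set.mem_ofPred_eq, Set.mem_iInter, Set.mem_preimage, Set.mem_compl_iff,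
        Set.mem_singleton_iff, ne_eq]
    rw [this]
    exact Finset.measurableSet_biInter _ fun z _ =>
      aux_meas_classifier k z (measurableSet_singleton b).compl
  rw [← hc.measure_preimage hmeas.nullMeasurableSet, Measure.prod_apply (hc.measurable hmeas)]
  set bad : Set (Fin n → Pt d) := ⋃ z ∈ t,
    {X | (Finset.univ.filter (fun i => X i ∈ ball z s)).card < k} with hbad
  have hcardm : ∀ z : Pt d, Measurable
      (fun X : Fin n → Pt d => (Finset.univ.filter (fun i => X i ∈ ball z s)).card) := by
    intro z
    simp_rw [Finset.card_filter]
    refine Finset.measurable_sum _ fun i _ => ?_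
    exact Measurable.ite (measurable_pi_apply i measurableSet_ball) measurable_const
      measurable_const
  have hbadm : MeasurableSet bad :=
    Finset.measurableSet_biUnion _ fun z _ => hcardm z (measurableSet_Iio (a := k))
  calc _ ≤ ∫⁻ X, (bad.indicator 1 X + (1 - auxUnif G ^ k) ^ t.card)
        ∂(Measure.pi fun _ : Fin n => D.map Prod.fst) := by
        refine lintegral_mono fun X => ?_
        by_cases hX : X ∈ bad
        · rw [Set.indicator_of_mem hX]
          exact prob_le_one.trans le_self_add
        · rw [Set.indicator_of_notMem hX, zero_add]
          have hX' : ∀ z ∈ t, k ≤ (Finset.univ.filter (fun i => X i ∈ ball z s)).card := by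
            intro z hz
            by_contra hlt
            exact hX (Set.mem_biUnion hz (not_le.1 hlt))
          have hkn : ∀ z ∈ t, k ≤ n := fun z hz =>
            (hX' z hz).trans ((Finset.card_le_univ _).trans (by simp))
          refine le_trans (measure_mono ?_)
            (aux_blocks k G hG (fun z => ((nnOrder X z).take k).toFinset) t ?_ ?_)
          · intro u hu z hz
            by_contra hcon
            push Not at hcon
            refine hu z hz (aux_classifier _ k hk (hkn z hz) z b ?_)
            intro a ha
            exact hb z hz (X a) (aux_take_mem X z s k (hX' z hz) a ha) (u a)
              (hcon a (List.mem_toFinset.2 ha))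
          · intro z hz
            rw [List.toFinset_card_of_nodup ((aux_nnOrder_nodup X z).sublist
              (List.take_sublist _ _)), List.length_take, aux_nnOrder_length]
            exact min_eq_left (hkn z hz)
          · intro z hz z' hz' hne
            rw [Finset.disjoint_left]
            intro a ha ha'
            exact Set.disjoint_left.1 (hdisj z hz z' hz' hne)
              (aux_take_mem X z s k (hX' z hz) a (List.mem_toFinset.1 ha))
              (aux_take_mem X z' s k (hX' z' hz') a (List.mem_toFinset.1 ha'))
    _ = (Measure.pi fun _ : Fin n => D.map Prod.fst) bad + (1 - auxUnif G ^ k) ^ t.card := by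
        rw [lintegral_add_right _ measurable_const, lintegral_indicator_one hbadm,
          lintegral_const, measure_univ, mul_one]
    _ ≤ _ := by
        gcongr
        exact measure_biUnion_finset_le _ _

lemma aux_final [Nonempty (Fin d)] (D : Measure (Pt d × Bool)) [IsProbabilityMeasure D]
    (η : Pt d → ℝ) (hη : IsCondProb D η)
    (hac : D.map Prod.fst ≪ (volume : Measure (Pt d)))
    (x : Pt d) (hx : x ∈ msupport (D.map Prod.fst)) (k : ℕ) (hk : 0 < k)
    (r : ℝ) (hr : 0 < r) (G : Set ℝ) (hG : MeasurableSet G) (hGpos : 0 < auxUnif G) (b : Bool)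
    (hb : ∀ y ∈ ball x r, ∀ u ∈ G, decide (u < η y) = b) (δ : ℝ≥0∞) (hδ : 0 < δ) :
    ∀ᶠ n in atTop, Pn D n {S | ∀ z ∈ ball x r, kNNClassifier S k z ≠ b} ≤ δ := by
  have : IsProbabilityMeasure (D.map Prod.fst) :=
    Measure.isProbabilityMeasure_map measurable_fst.aemeasurable
  have hq : 1 - auxUnif G ^ k < 1 :=
    ENNReal.sub_lt_self ENNReal.one_ne_top one_ne_zero (pow_ne_zero k hGpos.ne')
  have hδ2 : 0 < δ / 2 := ENNReal.half_pos hδ.ne'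
  obtain ⟨M, hM⟩ := ((ENNReal.tendsto_pow_atTop_nhds_zero_of_lt_one hq).eventually
    (gt_mem_nhds hδ2)).exists
  obtain ⟨t, hcard, s, hs, ht, hdisj⟩ := aux_points _ hac x hx r hr M
  have hlim : Tendsto (fun n : ℕ => ∑ z ∈ t, (Measure.pi fun _ : Fin n => D.map Prod.fst)
        {X | (Finset.univ.filter (fun i => X i ∈ ball z s)).card < k}) atTop (nhds 0) := by
    have := tendsto_finsetSum t (fun z hz =>
      aux_count_tendsto (D.map Prod.fst) (ball z s) measurableSet_ball (ht z hz).1 k hk)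
    simpa using this
  filter_upwards [hlim.eventually (gt_mem_nhds hδ2)] with n hn
  calc Pn D n {S | ∀ z ∈ ball x r, kNNClassifier S k z ≠ b}
      ≤ Pn D n {S | ∀ z ∈ t, kNNClassifier S k z ≠ b} :=
        measure_mono fun S (hS : ∀ z ∈ ball x r, kNNClassifier S k z ≠ b) z hz => hS z (ht z hz).2.1
    _ ≤ _ := aux_main D η hη k hk n t s hdisj G hG b
        (fun z hz y hy => hb y ((ht z hz).2.2 hy))
    _ ≤ δ / 2 + δ / 2 := by
        rw [hcard]
        exact add_le_add hn.le hM.le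
    _ = δ := ENNReal.add_halves δ

lemma aux_robust (f : Pt d → Bool) (x : Pt d) (ε : ℝ) (hε : 0 < ε)
    (h : ε ≤ robustRadius f x) :
    (∃ y, f y ≠ f x) ∧ ∀ z ∈ ball x ε, f z = f x := by
  constructor
  · by_contra hcon
    push Not at hcon
    have : {r : ℝ | 0 ≤ r ∧ ∃ x' ∈ closedBall x r, f x' ≠ f x} = ∅ := by
      ext r; simp [hcon]
    rw [robustRadius, this, Real.sInf_empty] at h
    linarith
  · intro z hz
    by_contra hcon
    have : robustRadius f x ≤ dist z x :=
      csInf_le ⟨0, fun r hr => hr.1⟩ ⟨dist_nonneg, z, mem_closedBall.2 le_rfl, hcon⟩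
    rw [mem_ball] at hz
    linarith

/-- For fixed `k`, at a support point `x` where `μ` is absolutely continuous
w.r.t. Lebesgue measure, `η(x) ∈ (0,1)`, and `η` is continuous in a neighborhood of `x`,
the robustness radius of the `k`-NN classifier at `x` converges in probability to `0`. -/
theorem stmt_0 (d : ℕ) (D : Measure (Pt d × Bool)) [IsProbabilityMeasure D]
    (η : Pt d → ℝ) (hη : IsCondProb D η)
    (hac : D.map Prod.fst ≪ (volume : Measure (Pt d)))
    (x : Pt d) (hx : x ∈ msupport (D.map Prod.fst))
    (hx01 : η x ∈ Set.Ioo (0 : ℝ) 1)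
    (hcont : ∃ U ∈ nhds x, ContinuousOn η U)
    (k : ℕ) :
    ∀ ε > (0 : ℝ), ∀ δ > (0 : ℝ), ∃ n₀ : ℕ, ∀ n ≥ n₀,
      Pn D n {S | ε ≤ robustRadius (kNNClassifier S k) x} ≤ ENNReal.ofReal δ := by
  intro ε hε δ hδ
  by_cases htriv : d = 0 ∨ k = 0
  · refine ⟨0, fun n _ => ?_⟩
    have : {S : Fin n → Pt d × Bool | ε ≤ robustRadius (kNNClassifier S k) x} = ∅ := by
      ext S
      simp only [Set.mem_ofPred_eq, Set.mem_empty_iff_false, iff_false]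
      intro h
      obtain ⟨⟨y, hy⟩, _⟩ := aux_robust _ _ _ hε h
      rcases htriv with h0 | h0
      · subst h0
        exact hy (by rw [Subsingleton.elim y x])
      · subst h0
        exact hy (by simp [kNNClassifier])
    rw [this]; simp
  push Not at htriv
  obtain ⟨hd0, hk0⟩ := htriv
  have hk : 0 < k := Nat.pos_of_ne_zero hk0
  have : Nonempty (Fin d) := ⟨⟨0, Nat.pos_of_ne_zero hd0⟩⟩
  obtain ⟨U, hU, hUc⟩ := hcont
  have hca : ContinuousAt η x := hUc.continuousAt hU
  obtain ⟨c, hc0, hcl, hcu⟩ : ∃ c : ℝ, 0 < c ∧ c < η x ∧ η x < 1 - c := by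
    refine ⟨min (η x) (1 - η x) / 2, ?_, ?_, ?_⟩
    · have := lt_min hx01.1 (sub_pos.2 hx01.2); linarith
    · have := min_le_left (η x) (1 - η x); linarith [hx01.1]
    · have := min_le_right (η x) (1 - η x); linarith [hx01.2]
  have hev : ∀ᶠ y in nhds x, c < η y ∧ η y < 1 - c :=
    (hca.eventually (lt_mem_nhds hcl)).and (hca.eventually (gt_mem_nhds hcu))
  obtain ⟨r₀, hr₀, hball⟩ := Metric.eventually_nhds_iff_ball.1 hev
  have hr : 0 < min r₀ ε := lt_min hr₀ hε
  have hball' : ∀ y ∈ ball x (min r₀ ε), c < η y ∧ η y < 1 - c := fun y hy =>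
    hball y (ball_subset_ball (min_le_left _ _) hy)
  have hδ2 : 0 < ENNReal.ofReal δ / 2 := ENNReal.half_pos (ENNReal.ofReal_pos.2 hδ).ne'
  have hc1 : c ≤ 1 := by linarith [hx01.2]
  have e1 := aux_final D η hη hac x hx k hk _ hr {u | u < c} measurableSet_Iio
    (by rw [auxUnif_lt hc0.le hc1]; exact ENNReal.ofReal_pos.2 hc0) true
    (fun y hy u hu => decide_eq_true (lt_trans hu (hball' y hy).1)) _ hδ2
  have e2 := aux_final D η hη hac x hx k hk _ hr {u | 1 - c < u} measurableSet_Ioi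
    (by rw [auxUnif_gt hc0.le hc1]; exact ENNReal.ofReal_pos.2 hc0) false
    (fun y hy u hu => decide_eq_false (not_lt.2 (lt_trans (hball' y hy).2 hu).le)) _ hδ2
  obtain ⟨n₀, hn₀⟩ := Filter.eventually_atTop.1 (e1.and e2)
  refine ⟨n₀, fun n hn => ?_⟩
  obtain ⟨h1, h2⟩ := hn₀ n hn
  calc _ ≤ Pn D n ({S | ∀ z ∈ ball x (min r₀ ε), kNNClassifier S k z ≠ true} ∪
        {S | ∀ z ∈ ball x (min r₀ ε), kNNClassifier S k z ≠ false}) := by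
        refine measure_mono fun S hS => ?_
        have hall := (aux_robust _ _ _ hε hS).2
        have hall' : ∀ z ∈ ball x (min r₀ ε), kNNClassifier S k z = kNNClassifier S k x :=
          fun z hz => hall z (ball_subset_ball (min_le_right _ _) hz)
        cases hv : kNNClassifier S k x
        · left; intro z hz; rw [hall' z hz, hv]; simp
        · right; intro z hz; rw [hall' z hz, hv]; simp
    _ ≤ _ := measure_union_le _ _
    _ ≤ ENNReal.ofReal δ / 2 + ENNReal.ofReal δ / 2 := add_le_add h1 h2
    _ = ENNReal.ofReal δ := ENNReal.add_halves _

end
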